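/- Let ρ be an elliptic N-function. Then for every δ > 0 there exists C_δ ≥ 1, depending only on δ and the characteristics of ρ, such that for all a, b ∈ ℝ^d and all t ≥ 0 one has ρ_{|a|}(t) ≤ C_δ ρ_{|b|}(t) + δ ρ_{|a|}(|a − b|) and (ρ_{|a|})*(t) ≤ C_δ (ρ_{|b|})*(t) + δ ρ_{|a|}(|a − b|). -/

import Mathlib

open MeasureTheory Set Filter

noncomputable section

/-- An elliptic N-function `ρ` with (given) first and second derivatives `ρ'`, `ρ''` on
`[0,∞)` resp. `(0,∞)`, and characteristics `γ₁ ≤ γ₂`:  `ρ` is continuous, strictly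
increasing and convex on `[0,∞)` with `ρ(0) = 0`, `ρ(t)/t → 0` as `t → 0⁺`,
`t/ρ(t) → 0` as `t → ∞`, `ρ` is `C¹` on `[0,∞)` and `C²` on `(0,∞)`, and
`γ₁ ρ'(t) ≤ t ρ''(t) ≤ γ₂ ρ'(t)` for all `t > 0`. -/
structure IsEllipticNFun (ρ ρ' ρ'' : ℝ → ℝ) (γ₁ γ₂ : ℝ) : Prop where
  continuousOn : ContinuousOn ρ (Set.Ici 0)
  strictMonoOn : StrictMonoOn ρ (Set.Ici 0)
  convexOn : ConvexOn ℝ (Set.Ici 0) ρ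
  map_zero : ρ 0 = 0
  tendsto_zero : Filter.Tendsto (fun t => ρ t / t) (nhdsWithin 0 (Set.Ioi 0)) (nhds 0)
  tendsto_atTop : Filter.Tendsto (fun t => t / ρ t) Filter.atTop (nhds 0)
  hasDerivAt : ∀ t ∈ Set.Ici (0:ℝ), HasDerivWithinAt ρ (ρ' t) (Set.Ici 0) t
  derivContinuousOn : ContinuousOn ρ' (Set.Ici 0)
  hasDeriv2At : ∀ t ∈ Set.Ioi (0:ℝ), HasDerivAt ρ' (ρ'' t) t
  deriv2ContinuousOn : ContinuousOn ρ'' (Set.Ioi 0)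
  gamma_pos : 0 < γ₁
  gamma_le : γ₁ ≤ γ₂
  elliptic : ∀ t ∈ Set.Ioi (0:ℝ), γ₁ * ρ' t ≤ t * ρ'' t ∧ t * ρ'' t ≤ γ₂ * ρ' t

/-- The shift of a function with derivative `g`: `shift g a t = ∫₀ᵗ (g(a+τ)/(a+τ)) τ dτ`.
For `g = ρ'` this is the shifted N-function `ρ_a`. -/
def shift (g : ℝ → ℝ) (a t : ℝ) : ℝ :=
  ∫ τ in (0:ℝ)..t, (g (a + τ) / (a + τ)) * τ

/-- The derivative of the shifted function: `(ρ_a)'(t) = (ρ'(a+t)/(a+t)) t` for `g = ρ'`. -/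
def shiftD (g : ℝ → ℝ) (a t : ℝ) : ℝ :=
  (g (a + t) / (a + t)) * t

/-- The conjugate (Legendre transform) `f*(t) = sup_{s ≥ 0} (s t - f(s))`. -/
def conj (f : ℝ → ℝ) (t : ℝ) : ℝ :=
  sSup ((fun s => s * t - f s) '' Set.Ici 0)

namespace IsEllipticNFun

variable {ρ ρ' ρ'' : ℝ → ℝ} {γ₁ γ₂ : ℝ}

lemma deriv_nonneg (h : IsEllipticNFun ρ ρ' ρ'' γ₁ γ₂) {x : ℝ} (hx : 0 < x) : 0 ≤ ρ' x := by
  have hd : HasDerivAt ρ (ρ' x) x := (h.hasDerivAt x hx.le).hasDerivAt (Ici_mem_nhds hx)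
  have := h.strictMonoOn.monotoneOn.derivWithin_nonneg (x := x)
  rwa [(h.hasDerivAt x hx.le).derivWithin (uniqueDiffOn_Ici 0 x hx.le)] at this

lemma monotoneOn_deriv (h : IsEllipticNFun ρ ρ' ρ'' γ₁ γ₂) : MonotoneOn ρ' (Ioi 0) := by
  refine monotoneOn_of_deriv_nonneg (convex_Ioi 0)
    (h.derivContinuousOn.mono Ioi_subset_Ici_self) ?_ ?_
  · rw [interior_Ioi]
    exact fun x hx => (h.hasDeriv2At x hx).differentiableAt.differentiableWithinAt
  · rw [interior_Ioi]
    intro x hx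
    rw [(h.hasDeriv2At x hx).deriv]
    have h1 := (h.elliptic x hx).1
    have h2 := mul_nonneg h.gamma_pos.le (h.deriv_nonneg hx)
    exact nonneg_of_mul_nonneg_right (h2.trans h1) hx

lemma deriv_pos (h : IsEllipticNFun ρ ρ' ρ'' γ₁ γ₂) {x : ℝ} (hx : 0 < x) : 0 < ρ' x := by
  obtain ⟨c, hc, hcx⟩ := exists_hasDerivAt_eq_slope ρ ρ' hx
    (h.continuousOn.mono Icc_subset_Ici_self)
    fun y hy => (h.hasDerivAt y hy.1.le).hasDerivAt (Ici_mem_nhds hy.1)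
  have hρ : ρ 0 < ρ x := h.strictMonoOn self_mem_Ici hx.le hx
  have hc' : 0 < ρ' c := by
    rw [hcx]
    exact div_pos (sub_pos.2 hρ) (sub_pos.2 hx)
  exact hc'.trans_le (h.monotoneOn_deriv hc.1 hx hc.2.le)

lemma hasDerivAt_deriv_mul_rpow (h : IsEllipticNFun ρ ρ' ρ'' γ₁ γ₂) (γ : ℝ) {x : ℝ}
    (hx : 0 < x) :
    HasDerivAt (fun t => ρ' t * t ^ (-γ)) (x ^ (-γ - 1) * (x * ρ'' x - γ * ρ' x)) x := by
  refine ((h.hasDeriv2At x hx).mul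
    (Real.hasDerivAt_rpow_const (p := -γ) (Or.inl hx.ne'))).congr_deriv ?_
  have : x ^ (-γ) = x ^ (-γ - 1) * x := by
    rw [Real.rpow_sub_one hx.ne', div_mul_cancel₀ _ hx.ne']
  rw [this]
  ring

lemma rpow_mul_deriv_le (h : IsEllipticNFun ρ ρ' ρ'' γ₁ γ₂) {l x : ℝ} (hl : 1 ≤ l)
    (hx : 0 < x) : l ^ γ₁ * ρ' x ≤ ρ' (l * x) := by
  have hm : MonotoneOn (fun t => ρ' t * t ^ (-γ₁)) (Ioi 0) := by
    refine monotoneOn_of_deriv_nonneg (convex_Ioi 0)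
      (fun y hy => (h.hasDerivAt_deriv_mul_rpow γ₁ hy).continuousAt.continuousWithinAt) ?_ ?_
    all_goals rw [interior_Ioi]; intro y hy
    · exact (h.hasDerivAt_deriv_mul_rpow γ₁ hy).differentiableAt.differentiableWithinAt
    · rw [(h.hasDerivAt_deriv_mul_rpow γ₁ hy).deriv]
      exact mul_nonneg (Real.rpow_nonneg (le_of_lt hy) _) (sub_nonneg.2 (h.elliptic y hy).1)
  have hl0 : 0 < l := by linarith
  have := hm hx (mul_pos hl0 hx) (le_mul_of_one_le_left hx.le hl)
  simp only [Real.mul_rpow hl0.le hx.le, Real.rpow_neg hl0.le, ← mul_assoc] at this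
  have := le_of_mul_le_mul_right this (Real.rpow_pos_of_pos hx _)
  rwa [← div_eq_mul_inv, le_div_iff₀ (Real.rpow_pos_of_pos hl0 _), mul_comm (ρ' x)] at this

lemma deriv_le_rpow_mul (h : IsEllipticNFun ρ ρ' ρ'' γ₁ γ₂) {l x : ℝ} (hl : 1 ≤ l)
    (hx : 0 < x) : ρ' (l * x) ≤ l ^ γ₂ * ρ' x := by
  have hm : AntitoneOn (fun t => ρ' t * t ^ (-γ₂)) (Ioi 0) := by
    refine antitoneOn_of_deriv_nonpos (convex_Ioi 0)
      (fun y hy => (h.hasDerivAt_deriv_mul_rpow γ₂ hy).continuousAt.continuousWithinAt) ?_ ?_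
    all_goals rw [interior_Ioi]; intro y hy
    · exact (h.hasDerivAt_deriv_mul_rpow γ₂ hy).differentiableAt.differentiableWithinAt
    · rw [(h.hasDerivAt_deriv_mul_rpow γ₂ hy).deriv]
      exact mul_nonpos_of_nonneg_of_nonpos (Real.rpow_nonneg (le_of_lt hy) _)
        (sub_nonpos.2 (h.elliptic y hy).2)
  have hl0 : 0 < l := by linarith
  have := hm hx (mul_pos hl0 hx) (le_mul_of_one_le_left hx.le hl)
  simp only [Real.mul_rpow hl0.le hx.le, Real.rpow_neg hl0.le, ← mul_assoc] at this
  have := le_of_mul_le_mul_right this (Real.rpow_pos_of_pos hx _)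
  rwa [← div_eq_mul_inv, div_le_iff₀ (Real.rpow_pos_of_pos hl0 _), mul_comm (ρ' x)] at this

lemma shiftD_nonneg (h : IsEllipticNFun ρ ρ' ρ'' γ₁ γ₂) {a t : ℝ} (ha : 0 ≤ a) (ht : 0 ≤ t) :
    0 ≤ shiftD ρ' a t := by
  rcases ht.eq_or_lt with rfl | ht
  · simp [shiftD]
  · have hat : 0 < a + t := by linarith
    exact mul_nonneg (div_nonneg (h.deriv_nonneg hat) hat.le) ht.le

lemma monotoneOn_shiftD (h : IsEllipticNFun ρ ρ' ρ'' γ₁ γ₂) {a : ℝ} (ha : 0 ≤ a) :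
    MonotoneOn (shiftD ρ' a) (Ici 0) := by
  intro s hs t ht hst
  rw [mem_Ici] at hs ht
  rcases hs.eq_or_lt with rfl | hs
  · simpa [shiftD] using h.shiftD_nonneg ha ht
  have has : 0 < a + s := by linarith
  have hat : 0 < a + t := by linarith
  have hg : ρ' (a + s) ≤ ρ' (a + t) := h.monotoneOn_deriv has hat (by linarith)
  have hq : s / (a + s) ≤ t / (a + t) := by
    rw [div_le_div_iff₀ has hat]
    nlinarith
  calc shiftD ρ' a s = ρ' (a + s) * (s / (a + s)) := by rw [shiftD]; ring
    _ ≤ ρ' (a + t) * (t / (a + t)) :=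
      mul_le_mul hg hq (by positivity) (h.deriv_nonneg hat)
    _ = shiftD ρ' a t := by rw [shiftD]; ring

lemma intervalIntegrable_shiftD (h : IsEllipticNFun ρ ρ' ρ'' γ₁ γ₂) {a s t : ℝ} (ha : 0 ≤ a)
    (hs : 0 ≤ s) (ht : 0 ≤ t) : IntervalIntegrable (shiftD ρ' a) volume s t :=
  ((h.monotoneOn_shiftD ha).mono fun _ hx => (le_min hs ht).trans hx.1).intervalIntegrable

lemma shift_sub (h : IsEllipticNFun ρ ρ' ρ'' γ₁ γ₂) {a s t : ℝ} (ha : 0 ≤ a)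
    (hs : 0 ≤ s) (ht : 0 ≤ t) :
    shift ρ' a t - shift ρ' a s = ∫ τ in s..t, shiftD ρ' a τ :=
  intervalIntegral.integral_interval_sub_left (h.intervalIntegrable_shiftD ha le_rfl ht)
    (h.intervalIntegrable_shiftD ha le_rfl hs)

lemma shift_sub_le (h : IsEllipticNFun ρ ρ' ρ'' γ₁ γ₂) {a s t : ℝ} (ha : 0 ≤ a)
    (hs : 0 ≤ s) (hst : s ≤ t) :
    shift ρ' a t - shift ρ' a s ≤ (t - s) * shiftD ρ' a t := by
  have ht := hs.trans hst
  rw [h.shift_sub ha hs ht, ← smul_eq_mul, ← intervalIntegral.integral_const]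
  exact intervalIntegral.integral_mono_on hst (h.intervalIntegrable_shiftD ha hs ht)
    intervalIntegrable_const
    fun x hx => h.monotoneOn_shiftD ha (hs.trans hx.1) ht hx.2

lemma le_shift_sub (h : IsEllipticNFun ρ ρ' ρ'' γ₁ γ₂) {a s t : ℝ} (ha : 0 ≤ a)
    (hs : 0 ≤ s) (hst : s ≤ t) :
    (t - s) * shiftD ρ' a s ≤ shift ρ' a t - shift ρ' a s := by
  have ht := hs.trans hst
  rw [h.shift_sub ha hs ht, ← smul_eq_mul, ← intervalIntegral.integral_const]
  exact intervalIntegral.integral_mono_on hst intervalIntegrable_const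
    (h.intervalIntegrable_shiftD ha hs ht)
    fun x hx => h.monotoneOn_shiftD ha hs (hs.trans hx.1) hx.1

lemma shift_nonneg (h : IsEllipticNFun ρ ρ' ρ'' γ₁ γ₂) {a t : ℝ} (ha : 0 ≤ a) (ht : 0 ≤ t) :
    0 ≤ shift ρ' a t :=
  intervalIntegral.integral_nonneg ht fun _ hx => h.shiftD_nonneg ha hx.1

lemma shift_le_mul_shiftD (h : IsEllipticNFun ρ ρ' ρ'' γ₁ γ₂) {a t : ℝ} (ha : 0 ≤ a)
    (ht : 0 ≤ t) : shift ρ' a t ≤ t * shiftD ρ' a t := by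
  simpa [shift] using h.shift_sub_le ha le_rfl ht

lemma mul_shiftD_le_shift (h : IsEllipticNFun ρ ρ' ρ'' γ₁ γ₂) {a ε D : ℝ} (ha : 0 ≤ a)
    (hε : 0 ≤ ε) (hε' : ε ≤ 1 / 2) (hD : 0 ≤ D) :
    ε * D * shiftD ρ' a (ε * D) ≤ 2 * ε * shift ρ' a D := by
  have h1 := h.le_shift_sub ha (div_nonneg hD zero_le_two) (half_le_self hD)
  have h2 := h.shift_nonneg ha (div_nonneg hD zero_le_two)
  have h3 : shiftD ρ' a (ε * D) ≤ shiftD ρ' a (D / 2) :=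
    h.monotoneOn_shiftD ha (mem_Ici.2 (by positivity)) (div_nonneg hD zero_le_two) (by nlinarith)
  calc ε * D * shiftD ρ' a (ε * D) ≤ ε * D * shiftD ρ' a (D / 2) := by gcongr
    _ = 2 * ε * ((D - D / 2) * shiftD ρ' a (D / 2)) := by ring
    _ ≤ 2 * ε * shift ρ' a D := by gcongr; linarith

lemma shiftD_le_mul_shiftD (h : IsEllipticNFun ρ ρ' ρ'' γ₁ γ₂) {a b M t : ℝ} (ha : 0 ≤ a)
    (hb : 0 ≤ b) (ht : 0 ≤ t) (hM : 1 ≤ M) (hab : a + t ≤ M * (b + t))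
    (hba : b + t ≤ M * (a + t)) :
    shiftD ρ' a t ≤ M ^ (γ₂ + 1) * shiftD ρ' b t := by
  rcases ht.eq_or_lt with rfl | ht
  · simp [shiftD]
  have hat : 0 < a + t := by linarith
  have hbt : 0 < b + t := by linarith
  have hM0 : 0 < M := by linarith
  have hg : ρ' (a + t) ≤ M ^ γ₂ * ρ' (b + t) :=
    (h.monotoneOn_deriv hat (mul_pos hM0 hbt) hab).trans (h.deriv_le_rpow_mul hM hbt)
  have hi : 1 / (a + t) ≤ M * (1 / (b + t)) := by
    rw [mul_one_div, div_le_div_iff₀ hat hbt]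
    linarith
  calc shiftD ρ' a t = ρ' (a + t) * (1 / (a + t)) * t := by rw [shiftD]; ring
    _ ≤ (M ^ γ₂ * ρ' (b + t)) * (M * (1 / (b + t))) * t := by
      have := h.deriv_nonneg hbt
      gcongr
    _ = M ^ (γ₂ + 1) * shiftD ρ' b t := by rw [shiftD, Real.rpow_add_one hM0.ne']; ring

lemma rpow_mul_shiftD_le (h : IsEllipticNFun ρ ρ' ρ'' γ₁ γ₂) {b l t : ℝ} (hb : 0 ≤ b)
    (ht : 0 ≤ t) (hl : 1 ≤ l) :
    l ^ min 1 γ₁ * shiftD ρ' b t ≤ shiftD ρ' b (l * t) := by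
  rcases ht.eq_or_lt with rfl | ht
  · simp [shiftD]
  have hl0 : 0 < l := by linarith
  have hbt : 0 < b + t := by linarith
  have hlt : t ≤ l * t := le_mul_of_one_le_left ht.le hl
  have hblt : 0 < b + l * t := by linarith
  set m := (b + l * t) / (b + t)
  have hmeq : m * (b + t) = b + l * t := div_mul_cancel₀ _ hbt.ne'
  have hm1 : 1 ≤ m := (one_le_div hbt).2 (by linarith)
  have hm0 : 0 < m := by linarith
  have hml : m ≤ l := (div_le_iff₀ hbt).2 (by nlinarith)
  have hg : m ^ min 1 γ₁ * ρ' (b + t) ≤ ρ' (b + l * t) := by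
    rw [← hmeq]
    refine le_trans ?_ (h.rpow_mul_deriv_le hm1 hbt)
    exact mul_le_mul_of_nonneg_right
      (Real.rpow_le_rpow_of_exponent_le hm1 (min_le_right _ _)) (h.deriv_nonneg hbt)
  have hp : l ^ (min 1 γ₁ - 1) ≤ m ^ (min 1 γ₁ - 1) :=
    Real.rpow_le_rpow_of_nonpos hm0 hml (sub_nonpos.2 (min_le_left _ _))
  have hG := h.shiftD_nonneg hb ht.le
  calc l ^ min 1 γ₁ * shiftD ρ' b t = l ^ (min 1 γ₁ - 1) * (l * shiftD ρ' b t) := by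
        rw [Real.rpow_sub_one hl0.ne']; field_simp
    _ ≤ m ^ (min 1 γ₁ - 1) * (l * shiftD ρ' b t) := by gcongr
    _ = m ^ min 1 γ₁ * ρ' (b + t) / (m * (b + t)) * (l * t) := by
        rw [Real.rpow_sub_one hm0.ne', shiftD]; field_simp
    _ ≤ shiftD ρ' b (l * t) := by
        rw [hmeq, shiftD]
        gcongr

lemma rpow_mul_shift_le (h : IsEllipticNFun ρ ρ' ρ'' γ₁ γ₂) {b l t : ℝ} (hb : 0 ≤ b)
    (ht : 0 ≤ t) (hl : 1 ≤ l) :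
    l * l ^ min 1 γ₁ * shift ρ' b t ≤ shift ρ' b (l * t) := by
  have hl0 : 0 < l := by linarith
  have heq : l * ∫ τ in (0 : ℝ)..t, shiftD ρ' b (l * τ) = shift ρ' b (l * t) := by
    rw [← smul_eq_mul, intervalIntegral.smul_integral_comp_mul_left, mul_zero]
    rfl
  have hmono : MonotoneOn (fun τ => shiftD ρ' b (l * τ)) (Ici 0) := fun x hx y hy hxy =>
    h.monotoneOn_shiftD hb (mul_nonneg hl0.le hx) (mul_nonneg hl0.le hy)
      (mul_le_mul_of_nonneg_left hxy hl0.le)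
  rw [← heq, mul_assoc]
  refine mul_le_mul_of_nonneg_left ?_ hl0.le
  change l ^ min 1 γ₁ * (∫ τ in (0 : ℝ)..t, shiftD ρ' b τ) ≤ _
  rw [← intervalIntegral.integral_const_mul]
  refine intervalIntegral.integral_mono_on ht
    ((h.intervalIntegrable_shiftD hb le_rfl ht).const_mul _) ?_
    fun x hx => h.rpow_mul_shiftD_le hb hx.1 hl
  exact (hmono.mono fun _ hx => (le_min le_rfl ht).trans hx.1).intervalIntegrable

lemma exists_le_shiftD (h : IsEllipticNFun ρ ρ' ρ'' γ₁ γ₂) {b : ℝ} (hb : 0 ≤ b) (t : ℝ) :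
    ∃ T, 0 ≤ T ∧ t ≤ shiftD ρ' b T := by
  have hp : 0 < min 1 γ₁ := lt_min one_pos h.gamma_pos
  have hc : 0 < shiftD ρ' b 1 := by
    have hb1 : 0 < b + 1 := by linarith
    have := h.deriv_pos hb1
    rw [shiftD]
    positivity
  have hlim : Tendsto (fun l : ℝ => l ^ min 1 γ₁ * shiftD ρ' b 1) atTop atTop :=
    (tendsto_rpow_atTop hp).atTop_mul_const hc
  obtain ⟨l, hlt, hl⟩ := ((hlim.eventually_ge_atTop t).and (eventually_ge_atTop 1)).exists
  refine ⟨l, by linarith, hlt.trans ?_⟩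
  simpa using h.rpow_mul_shiftD_le hb zero_le_one hl

lemma bddAbove_conj_shift (h : IsEllipticNFun ρ ρ' ρ'' γ₁ γ₂) {b t : ℝ} (hb : 0 ≤ b)
    (ht : 0 ≤ t) : BddAbove ((fun s => s * t - shift ρ' b s) '' Ici 0) := by
  obtain ⟨T, hT, hTt⟩ := h.exists_le_shiftD hb t
  refine ⟨T * t, ?_⟩
  rintro _ ⟨s, hs, rfl⟩
  rw [mem_Ici] at hs
  show s * t - shift ρ' b s ≤ T * t
  rcases le_total s T with hsT | hTs
  · nlinarith [h.shift_nonneg hb hs]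
  · nlinarith [h.shift_nonneg hb hT, h.le_shift_sub hb hT hTs]

lemma le_conj_shift (h : IsEllipticNFun ρ ρ' ρ'' γ₁ γ₂) {b s t : ℝ} (hb : 0 ≤ b)
    (hs : 0 ≤ s) (ht : 0 ≤ t) : s * t - shift ρ' b s ≤ conj (shift ρ' b) t :=
  le_csSup (h.bddAbove_conj_shift hb ht) ⟨s, hs, rfl⟩

lemma conj_shift_nonneg (h : IsEllipticNFun ρ ρ' ρ'' γ₁ γ₂) {b t : ℝ} (hb : 0 ≤ b)
    (ht : 0 ≤ t) : 0 ≤ conj (shift ρ' b) t := by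
  simpa [shift] using h.le_conj_shift hb le_rfl ht

/-- The shifted derivatives with shifts at distance at most `D` are comparable on `[ε D, ∞)`. -/
lemma shiftD_le_of_mul_le (h : IsEllipticNFun ρ ρ' ρ'' γ₁ γ₂) {a b D ε t : ℝ} (ha : 0 ≤ a)
    (hb : 0 ≤ b) (hD : 0 ≤ D) (hab : a ≤ b + D) (hba : b ≤ a + D) (hε : 0 < ε)
    (ht : ε * D ≤ t) :
    shiftD ρ' a t ≤ (1 + 1 / ε) ^ (γ₂ + 1) * shiftD ρ' b t := by
  have ht0 : 0 ≤ t := (mul_nonneg hε.le hD).trans ht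
  have hDt : D ≤ 1 / ε * t := by
    rw [one_div_mul_eq_div, le_div_iff₀ hε]
    linarith
  have hε0 : 0 < 1 / ε := by positivity
  refine h.shiftD_le_mul_shiftD ha hb ht0 (by linarith) ?_ ?_ <;> nlinarith

lemma shift_sub_le_of_mul_le (h : IsEllipticNFun ρ ρ' ρ'' γ₁ γ₂) {a b D ε t : ℝ} (ha : 0 ≤ a)
    (hb : 0 ≤ b) (hD : 0 ≤ D) (hab : a ≤ b + D) (hba : b ≤ a + D) (hε : 0 < ε)
    (ht : ε * D ≤ t) :
    shift ρ' a t - shift ρ' a (ε * D) ≤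
      (1 + 1 / ε) ^ (γ₂ + 1) * (shift ρ' b t - shift ρ' b (ε * D)) := by
  have hεD : 0 ≤ ε * D := mul_nonneg hε.le hD
  have ht0 : 0 ≤ t := hεD.trans ht
  rw [h.shift_sub ha hεD ht0, h.shift_sub hb hεD ht0, ← intervalIntegral.integral_const_mul]
  exact intervalIntegral.integral_mono_on ht (h.intervalIntegrable_shiftD ha hεD ht0)
    ((h.intervalIntegrable_shiftD hb hεD ht0).const_mul _)
    fun x hx => h.shiftD_le_of_mul_le ha hb hD hab hba hε hx.1

theorem shift_le_shift_add (h : IsEllipticNFun ρ ρ' ρ'' γ₁ γ₂) {a b D ε t : ℝ} (ha : 0 ≤ a)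
    (hb : 0 ≤ b) (hD : 0 ≤ D) (hab : a ≤ b + D) (hba : b ≤ a + D) (hε : 0 < ε)
    (hε' : ε ≤ 1 / 2) (ht : 0 ≤ t) :
    shift ρ' a t ≤ (1 + 1 / ε) ^ (γ₂ + 1) * shift ρ' b t + 2 * ε * shift ρ' a D := by
  have hεD : 0 ≤ ε * D := mul_nonneg hε.le hD
  have hK : 0 ≤ (1 + 1 / ε) ^ (γ₂ + 1) := by positivity
  have h1 := h.shift_le_mul_shiftD ha hεD
  have h2 := h.mul_shiftD_le_shift ha hε.le hε' hD
  rcases le_total t (ε * D) with hle | hle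
  · have h3 := h.shift_sub ha ht hεD
    have h4 : 0 ≤ ∫ τ in t..(ε * D), shiftD ρ' a τ :=
      intervalIntegral.integral_nonneg hle fun x hx => h.shiftD_nonneg ha (ht.trans hx.1)
    have h5 := mul_nonneg hK (h.shift_nonneg hb ht)
    linarith
  · have h3 := h.shift_sub_le_of_mul_le ha hb hD hab hba hε hle
    have h4 := mul_nonneg hK (h.shift_nonneg hb hεD)
    rw [mul_sub] at h3
    linarith

theorem conj_shift_le_conj_shift_add (h : IsEllipticNFun ρ ρ' ρ'' γ₁ γ₂) {a b D ε t : ℝ}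
    (ha : 0 ≤ a) (hb : 0 ≤ b) (hD : 0 ≤ D) (hab : a ≤ b + D) (hba : b ≤ a + D) (hε : 0 < ε)
    (hε' : ε ≤ 1 / 2) (ht : 0 ≤ t) :
    conj (shift ρ' a) t ≤
      ((1 + 1 / ε) ^ (γ₂ + 1)) ^ (1 / min 1 γ₁) * conj (shift ρ' b) t +
        2 * ε * shift ρ' a D := by
  have hp : 0 < min 1 γ₁ := lt_min one_pos h.gamma_pos
  have hγ₂ : 0 < γ₂ := h.gamma_pos.trans_le h.gamma_le
  have hεD : 0 ≤ ε * D := mul_nonneg hε.le hD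
  set K := (1 + 1 / ε) ^ (γ₂ + 1)
  have hK1 : 1 ≤ K :=
    Real.one_le_rpow (le_add_of_nonneg_right (by positivity)) (by positivity)
  have hK0 : 0 < K := by linarith
  set l := K ^ (1 / min 1 γ₁) with hldef
  have hl1 : 1 ≤ l := Real.one_le_rpow hK1 (by positivity)
  have hl0 : 0 < l := by linarith
  have hlK : l ^ min 1 γ₁ = K := by
    rw [hldef, ← Real.rpow_mul hK0.le, one_div_mul_cancel hp.ne', Real.rpow_one]
  have hsmall := h.mul_shiftD_le_shift ha hε.le hε' hD
  have hlarge : ∀ s, ε * D ≤ s →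
      s * t - shift ρ' a s ≤ l * conj (shift ρ' b) t + 2 * ε * shift ρ' a D := by
    intro s hs
    have hs0 : 0 ≤ s := hεD.trans hs
    have h1 : shift ρ' b s - shift ρ' b (ε * D) ≤ K * (shift ρ' a s - shift ρ' a (ε * D)) :=
      h.shift_sub_le_of_mul_le hb ha hD hba hab hε hs
    have h2 : shift ρ' b (ε * D) ≤ K * (2 * ε * shift ρ' a D) :=
      calc shift ρ' b (ε * D) ≤ ε * D * shiftD ρ' b (ε * D) := h.shift_le_mul_shiftD hb hεD
        _ ≤ ε * D * (K * shiftD ρ' a (ε * D)) := by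
          gcongr
          exact h.shiftD_le_of_mul_le hb ha hD hba hab hε le_rfl
        _ = K * (ε * D * shiftD ρ' a (ε * D)) := by ring
        _ ≤ K * (2 * ε * shift ρ' a D) := by gcongr
    have h3 : l * K * shift ρ' b (s / l) ≤ shift ρ' b s := by
      have := h.rpow_mul_shift_le hb (div_nonneg hs0 hl0.le) hl1
      rwa [hlK, mul_div_cancel₀ _ hl0.ne'] at this
    have h4 := h.le_conj_shift hb (div_nonneg hs0 hl0.le) ht
    have h5 : s * t - l * shift ρ' b (s / l) ≤ l * conj (shift ρ' b) t := by
      refine le_trans (le_of_eq ?_) (mul_le_mul_of_nonneg_left h4 hl0.le)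
      field_simp
    have h6 : K * (l * shift ρ' b (s / l)) ≤ K * (shift ρ' a s + 2 * ε * shift ρ' a D) := by
      have := mul_nonneg hK0.le (h.shift_nonneg ha hεD)
      linarith
    linarith [le_of_mul_le_mul_left h6 hK0]
  refine csSup_le (nonempty_Ici.image _) ?_
  rintro _ ⟨s, hs, rfl⟩
  rw [mem_Ici] at hs
  show s * t - shift ρ' a s ≤ _
  rcases le_total (ε * D) s with hle | hle
  · exact hlarge s hle
  rcases le_total t (shiftD ρ' a (ε * D)) with htle | htle
  · have h1 := mul_nonneg hl0.le (h.conj_shift_nonneg hb ht)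
    have h2 := h.shift_nonneg ha hs
    have h3 : s * t ≤ ε * D * shiftD ρ' a (ε * D) := mul_le_mul hle htle ht hεD
    linarith
  · have h1 := h.shift_sub_le ha hs hle
    have h2 := mul_le_mul_of_nonneg_left htle (sub_nonneg.2 hle)
    linarith [hlarge (ε * D) le_rfl]

end IsEllipticNFun

/-- Change of shift: for an elliptic N-function `ρ` and every `δ > 0` there is `C_δ ≥ 1`,
depending only on `δ` and the characteristics of `ρ`, such that for all `a, b ∈ ℝ^d` and
`t ≥ 0` one has `ρ_{|a|}(t) ≤ C_δ ρ_{|b|}(t) + δ ρ_{|a|}(|a - b|)` and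
`(ρ_{|a|})*(t) ≤ C_δ (ρ_{|b|})*(t) + δ ρ_{|a|}(|a - b|)`. -/
theorem change_of_shift (γ₁ γ₂ δ : ℝ) (hγ₁ : 0 < γ₁) (hγ : γ₁ ≤ γ₂) (hδ : 0 < δ) :
    ∃ C : ℝ, 1 ≤ C ∧
      ∀ ρ ρ' ρ'' : ℝ → ℝ, IsEllipticNFun ρ ρ' ρ'' γ₁ γ₂ →
        ∀ (d : ℕ) (a b : EuclideanSpace ℝ (Fin d)) (t : ℝ), 0 ≤ t →
          shift ρ' ‖a‖ t ≤ C * shift ρ' ‖b‖ t + δ * shift ρ' ‖a‖ ‖a - b‖ ∧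
          conj (shift ρ' ‖a‖) t ≤
            C * conj (shift ρ' ‖b‖) t + δ * shift ρ' ‖a‖ ‖a - b‖ := by
  have hε : 0 < min (δ / 2) (1 / 2) := lt_min (by positivity) (by positivity)
  have hp : 0 < min 1 γ₁ := lt_min one_pos hγ₁
  have hγ₂ : 0 < γ₂ := hγ₁.trans_le hγ
  set ε := min (δ / 2) (1 / 2)
  have hε₁ : ε ≤ δ / 2 := min_le_left _ _
  have hε₂ : ε ≤ 1 / 2 := min_le_right _ _
  have hK : 1 ≤ (1 + 1 / ε) ^ (γ₂ + 1) :=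
    Real.one_le_rpow (le_add_of_nonneg_right (by positivity)) (by positivity)
  set K := (1 + 1 / ε) ^ (γ₂ + 1)
  refine ⟨max K (K ^ (1 / min 1 γ₁)), hK.trans (le_max_left _ _), ?_⟩
  intro ρ ρ' ρ'' h d a b t ht
  have ha := norm_nonneg a
  have hb := norm_nonneg b
  have hD := norm_nonneg (a - b)
  have hab : ‖a‖ ≤ ‖b‖ + ‖a - b‖ := norm_le_norm_add_norm_sub' a b
  have hba : ‖b‖ ≤ ‖a‖ + ‖a - b‖ := norm_le_norm_add_norm_sub a b
  have hδD : 2 * ε * shift ρ' ‖a‖ ‖a - b‖ ≤ δ * shift ρ' ‖a‖ ‖a - b‖ :=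
    mul_le_mul_of_nonneg_right (by linarith) (h.shift_nonneg ha hD)
  constructor
  · exact (h.shift_le_shift_add ha hb hD hab hba hε hε₂ ht).trans
      (add_le_add (mul_le_mul_of_nonneg_right (le_max_left _ _) (h.shift_nonneg hb ht)) hδD)
  · exact (h.conj_shift_le_conj_shift_add ha hb hD hab hba hε hε₂ ht).trans
      (add_le_add (mul_le_mul_of_nonneg_right (le_max_right _ _) (h.conj_shift_nonneg hb ht)) hδD)
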